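/- Let L ≥ 1 and for l = 1, …, L let θ_l = (cos(π(l−1)/(2L)), sin(π(l−1)/(2L))) ∈ ℝ². Then for every v ∈ ℝ², Σ_{l=1}^L ⟪θ_l, v⟫² ≥ (L/2)·(1 − 1/(L·sin(π/(2L))))·‖v‖². (Smallest-eigenvalue bound γ(Θ) = (L/2)(1 − 1/(L sin(π/(2L)))) for Θ = Σ_l θ_l θ_lᵀ, used in the proof of Proposition 2.) -/

import Mathlib

open Real Finset
open scoped RealInnerProductSpace

noncomputable section

/-- Telescoped form of the Dirichlet-type sum of `cos (2kt)`. -/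
lemma two_mul_sin_mul_sum_cos (t : ℝ) (n : ℕ) :
    2 * sin t * ∑ k ∈ range n, cos (2 * (k * t)) = sin (2 * (n * t) - t) + sin t := by
  induction n with
  | zero => simp
  | succ n ih =>
    rw [sum_range_succ, mul_add, ih]
    have h : 2 * (((n + 1 : ℕ) : ℝ) * t) - t = 2 * (n * t) + t := by push_cast; ring
    rw [h, sin_add, sin_sub]
    ring

/-- Telescoped form of the Dirichlet-type sum of `sin (2kt)`. -/
lemma two_mul_sin_mul_sum_sin (t : ℝ) (n : ℕ) :
    2 * sin t * ∑ k ∈ range n, sin (2 * (k * t)) = cos t - cos (2 * (n * t) - t) := by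
  induction n with
  | zero => simp
  | succ n ih =>
    rw [sum_range_succ, mul_add, ih]
    have h : 2 * (((n + 1 : ℕ) : ℝ) * t) - t = 2 * (n * t) + t := by push_cast; ring
    rw [h, cos_add, cos_sub]
    ring

lemma sq_cos_add_sin (a b x : ℝ) :
    (a * cos x + b * sin x) ^ 2 =
      (a ^ 2 + b ^ 2) / 2 + (a ^ 2 - b ^ 2) / 2 * cos (2 * x) + a * b * sin (2 * x) := by
  rw [cos_two_mul, sin_two_mul]
  linear_combination b ^ 2 * sin_sq_add_cos_sq x

lemma neg_sq_add_sq_le_of_sq_add_sq_eq_one {s c : ℝ} (hs : 0 < s) (h : s ^ 2 + c ^ 2 = 1)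
    (a b : ℝ) : -(a ^ 2 + b ^ 2) ≤ (a ^ 2 - b ^ 2) * s + 2 * a * b * c := by
  have key : 0 ≤ (1 + s) * ((a ^ 2 - b ^ 2) * s + 2 * a * b * c + (a ^ 2 + b ^ 2)) := by
    have : (1 + s) * ((a ^ 2 - b ^ 2) * s + 2 * a * b * c + (a ^ 2 + b ^ 2)) =
        (a * (1 + s) + b * c) ^ 2 := by
      linear_combination -b ^ 2 * h
    rw [this]
    positivity
  linarith [nonneg_of_mul_nonneg_right key (by linarith)]

/-- Smallest-eigenvalue bound `γ(Θ) = (L/2)(1 − 1/(L sin(π/(2L))))` for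
`Θ = Σ_l θ_l θ_lᵀ` with the quarter-circle grid of directions, used in the proof of
Proposition 2: for every `v ∈ ℝ²`, `Σ_l ⟪θ_l, v⟫² ≥ (L/2)(1 − 1/(L sin(π/(2L))))‖v‖²`. -/
theorem theta_quadratic_form_lower_bound
    (L : ℕ) (hL : 1 ≤ L)
    (θ : Fin L → EuclideanSpace ℝ (Fin 2))
    (hθ : ∀ l : Fin L, θ l = (EuclideanSpace.equiv (Fin 2) ℝ).symm
      ![Real.cos (π * (l : ℕ) / (2 * (L : ℝ))), Real.sin (π * (l : ℕ) / (2 * (L : ℝ)))]) :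
    ∀ v : EuclideanSpace ℝ (Fin 2),
      ((L : ℝ) / 2) * (1 - 1 / ((L : ℝ) * Real.sin (π / (2 * (L : ℝ))))) * ‖v‖ ^ 2
        ≤ ∑ l : Fin L, ⟪θ l, v⟫ ^ 2 := by
  intro v
  have hL0 : (0 : ℝ) < L := by exact_mod_cast hL
  set t : ℝ := π / (2 * (L : ℝ)) with ht
  have hLt : 2 * ((L : ℝ) * t) = π := by rw [ht]; field_simp
  have hs : 0 < sin t := by
    have h1 : (1 : ℝ) ≤ L := by exact_mod_cast hL
    have ht0 : 0 < t := by positivity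
    exact sin_pos_of_pos_of_lt_pi ht0 (by nlinarith)
  have hC := two_mul_sin_mul_sum_cos t L
  have hS := two_mul_sin_mul_sum_sin t L
  rw [hLt, sin_pi_sub] at hC
  rw [hLt, cos_pi_sub] at hS
  have hterm : ∀ l : Fin L, ⟪θ l, v⟫ ^ 2 =
      (v 0 * cos ((l : ℕ) * t) + v 1 * sin ((l : ℕ) * t)) ^ 2 := by
    intro l
    have harg : π * (l : ℕ) / (2 * (L : ℝ)) = (l : ℕ) * t := by rw [ht]; ring
    rw [hθ l, harg]
    simp [PiLp.inner_apply, Fin.sum_univ_two]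
  have hsum : ∑ l : Fin L, ⟪θ l, v⟫ ^ 2 =
      L * ((v 0 ^ 2 + v 1 ^ 2) / 2)
        + (v 0 ^ 2 - v 1 ^ 2) / 2 * ∑ k ∈ range L, cos (2 * (k * t))
        + v 0 * v 1 * ∑ k ∈ range L, sin (2 * (k * t)) := by
    simp_rw [hterm, sq_cos_add_sin]
    rw [Fin.sum_univ_eq_sum_range (fun k : ℕ => (v 0 ^ 2 + v 1 ^ 2) / 2
      + (v 0 ^ 2 - v 1 ^ 2) / 2 * cos (2 * (k * t)) + v 0 * v 1 * sin (2 * (k * t))) L]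
    simp [sum_add_distrib, mul_sum]
  have hnorm : ‖v‖ ^ 2 = v 0 ^ 2 + v 1 ^ 2 := by
    simp [EuclideanSpace.norm_sq_eq, Fin.sum_univ_two]
  have hconst : (L : ℝ) / 2 * (1 - 1 / (L * sin t)) * sin t = (L * sin t - 1) / 2 := by
    field_simp
  rw [hsum, hnorm]
  refine le_of_mul_le_mul_right ?_ hs
  linear_combination (1 / 2) *
      neg_sq_add_sq_le_of_sq_add_sq_eq_one hs (sin_sq_add_cos_sq t) (v 0) (v 1)
    + (v 0 ^ 2 + v 1 ^ 2) * hconst - (v 0 ^ 2 - v 1 ^ 2) / 4 * hC - v 0 * v 1 / 2 * hS
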